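/- arXiv:2404.11880 — 2 statements merged into one kernel-verified Lean document; each statement's English description precedes it below -/
import Mathlib

section
/- Let g be a continuous real function on S_U and let α ∈ ℝ. Then Σ_{j=1}^k w_j Φ(f(A_j)) ≤ α·g(B_U) + ( max_{x ∈ S_U} (x − α·g(x)) )·1_K in the Loewner order, where 1_K is the identity operator on K. -/
open ContinuousLinearMap in
/-- The Kantorovich constant `K(m', M', r)`, with the convention that it equals `1`
for `r = 0` and `r = 1`. -/
noncomputable def kantorovich (m M r : ℝ) : ℝ :=
  if r = 0 ∨ r = 1 then 1 else
    ((m * M ^ r - M * m ^ r) / ((r - 1) * (M - m))) *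
      (((r - 1) * (M ^ r - m ^ r)) / (r * (m * M ^ r - M * m ^ r))) ^ r

open ContinuousLinearMap Polynomial

/-- The Kantorovich constant of a natural exponent is at least `1` on a positive interval. -/
theorem one_le_kantorovich_natCast {m M : ℝ} (hm : 0 < m) (hmM : m < M) (n : ℕ) :
    1 ≤ kantorovich m M (n : ℝ) := by
  unfold kantorovich
  split_ifs with h
  · exact le_rfl
  have hn : 2 ≤ n := by
    simp only [Nat.cast_eq_zero, Nat.cast_eq_one] at h
    omega
  obtain ⟨l, rfl⟩ : ∃ l, n = l + 2 := ⟨n - 2, by omega⟩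
  simp only [Real.rpow_natCast]
  have hM : 0 < M := hm.trans hmM
  have hd : 0 < M - m := sub_pos.2 hmM
  have hpow : m ^ (l + 1) < M ^ (l + 1) := pow_lt_pow_left₀ hmM hm.le (by omega)
  have hp : 0 < m * M ^ (l + 2) - M * m ^ (l + 2) := by
    have : m * M ^ (l + 2) - M * m ^ (l + 2) = m * M * (M ^ (l + 1) - m ^ (l + 1)) := by ring
    rw [this]
    exact mul_pos (mul_pos hm hM) (sub_pos.2 hpow)
  have hq : 0 < M ^ (l + 2) - m ^ (l + 2) :=
    sub_pos.2 (pow_lt_pow_left₀ hmM hm.le (by omega))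
  have hN : (((l + 2 : ℕ) : ℝ) - 1) = (l : ℝ) + 1 := by push_cast; ring
  rw [hN]
  set p := m * M ^ (l + 2) - M * m ^ (l + 2) with hpdef
  set q := M ^ (l + 2) - m ^ (l + 2) with hqdef
  have hl : (0 : ℝ) < (l : ℝ) + 1 := by positivity
  have hl2 : (0 : ℝ) < ((l + 2 : ℕ) : ℝ) := by positivity
  set t := ((l : ℝ) + 1) * q / (((l + 2 : ℕ) : ℝ) * p) with ht
  have ht0 : 0 < t := by positivity
  have bern : 1 + ((l + 2 : ℕ) : ℝ) * (m * t - 1) ≤ (m * t) ^ (l + 2) := by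
    have h0 : 0 < m * t := mul_pos hm ht0
    have := one_add_mul_le_pow (a := m * t - 1) (by linarith) (l + 2)
    simpa using this
  have key : p / (((l : ℝ) + 1) * (M - m)) * (1 + ((l + 2 : ℕ) : ℝ) * (m * t - 1))
      = m ^ (l + 2) := by
    have h1 : 1 + ((l + 2 : ℕ) : ℝ) * (m * t - 1) = ((l : ℝ) + 1) * (m * q - p) / p := by
      rw [ht]
      field_simp
      push_cast
      ring
    have h2 : m * q - p = m ^ (l + 2) * (M - m) := by
      rw [hpdef, hqdef]; ring
    rw [h1, h2]
    field_simp
  have hmp : 0 < m ^ (l + 2) := by positivity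
  have := mul_le_mul_of_nonneg_left bern
    (show 0 ≤ p / (((l : ℝ) + 1) * (M - m)) by positivity)
  rw [key, mul_pow] at this
  refine le_of_mul_le_mul_left ?_ hmp
  linarith

section Compression

variable {H K : Type*} [NormedAddCommGroup H] [InnerProductSpace ℂ H] [CompleteSpace H]
  [NormedAddCommGroup K] [InnerProductSpace ℂ K] [CompleteSpace K]
  {ι : Type*} [Fintype ι]

/-- Weighted sums of compressions `V* X V` are monotone in the Loewner order. -/
theorem sum_smul_adjoint_conj_mono (V : K →L[ℂ] H) {w : ι → ℝ} (hw : ∀ j, 0 ≤ w j)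
    {X Y : ι → H →L[ℂ] H} (h : ∀ j, X j ≤ Y j) :
    ∑ j, w j • (adjoint V ∘L X j ∘L V) ≤ ∑ j, w j • (adjoint V ∘L Y j ∘L V) := by
  refine Finset.sum_le_sum fun j _ => smul_le_smul_of_nonneg_left ?_ (hw j)
  rw [ContinuousLinearMap.le_def]
  have := IsPositive.adjoint_conj ((ContinuousLinearMap.le_def _ _).1 (h j)) V
  rwa [ContinuousLinearMap.sub_comp, comp_sub] at this

theorem sum_smul_adjoint_conj_algebraMap {V : K →L[ℂ] H} (hV : adjoint V ∘L V = 1)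
    {w : ι → ℝ} (hw1 : ∑ j, w j = 1) (c : ℝ) :
    ∑ j, w j • (adjoint V ∘L algebraMap ℝ (H →L[ℂ] H) c ∘L V) = algebraMap ℝ (K →L[ℂ] K) c := by
  have h : adjoint V ∘L algebraMap ℝ (H →L[ℂ] H) c ∘L V = algebraMap ℝ (K →L[ℂ] K) c := by
    rw [Algebra.algebraMap_eq_smul_one, Algebra.algebraMap_eq_smul_one,
      ContinuousLinearMap.smul_comp, comp_smul, one_def, id_comp, hV, one_def]
  rw [h, ← Finset.sum_smul, hw1, one_smul]

theorem isSelfAdjoint_sum_smul_adjoint_conj (V : K →L[ℂ] H) (w : ι → ℝ)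
    {X : ι → H →L[ℂ] H} (hX : ∀ j, IsSelfAdjoint (X j)) :
    IsSelfAdjoint (∑ j, w j • (adjoint V ∘L X j ∘L V)) :=
  isSelfAdjoint_sum _ fun j _ => (IsSelfAdjoint.all (w j)).smul ((hX j).adjoint_conj V)

/-- The spectrum of a convex combination of compressions of self-adjoint operators stays in any
compact convex set containing the spectra. -/
theorem spectrum_sum_smul_adjoint_conj_subset {V : K →L[ℂ] H} (hV : adjoint V ∘L V = 1)
    {w : ι → ℝ} (hw : ∀ j, 0 ≤ w j) (hw1 : ∑ j, w j = 1)
    {X : ι → H →L[ℂ] H} (hX : ∀ j, IsSelfAdjoint (X j))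
    {S : Set ℝ} (hS : IsCompact S) (hne : S.Nonempty) (hconv : Convex ℝ S)
    (hspec : ∀ j, spectrum ℝ (X j) ⊆ S) :
    spectrum ℝ (∑ j, w j • (adjoint V ∘L X j ∘L V)) ⊆ S := by
  have hsa := isSelfAdjoint_sum_smul_adjoint_conj V w hX
  have hlow := sum_smul_adjoint_conj_mono V hw fun j =>
    algebraMap_le_of_le_spectrum (fun x hx => csInf_le hS.bddBelow (hspec j hx)) (hX j)
  have hupp := sum_smul_adjoint_conj_mono V hw fun j =>
    le_algebraMap_of_spectrum_le (fun x hx => le_csSup hS.bddAbove (hspec j hx)) (hX j)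
  rw [sum_smul_adjoint_conj_algebraMap hV hw1] at hlow hupp
  rw [algebraMap_le_iff_le_spectrum hsa] at hlow
  rw [le_algebraMap_iff_spectrum_le hsa] at hupp
  intro x hx
  exact hconv.ordConnected.out (hS.sInf_mem hne) (hS.sSup_mem hne) ⟨hlow x hx, hupp x hx⟩

end Compression

/-- If `S` is a compact set containing the spectrum of the self-adjoint operator `B`, then
`B ≤ α g(B) + sup_{x ∈ S} (x - α g(x))`. -/
theorem le_smul_cfc_add_sSup_smul_one {K : Type*} [NormedAddCommGroup K] [InnerProductSpace ℂ K]
    [CompleteSpace K] {B : K →L[ℂ] K} (hB : IsSelfAdjoint B) {S : Set ℝ} (hS : IsCompact S)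
    (hspec : spectrum ℝ B ⊆ S) {g : ℝ → ℝ} (hg : ContinuousOn g S) (α : ℝ) :
    B ≤ α • cfc g B + sSup ((fun x => x - α * g x) '' S) • (1 : K →L[ℂ] K) := by
  have hcont : ContinuousOn (fun x => x - α * g x) S :=
    continuousOn_id.sub (continuousOn_const.mul hg)
  have hgB : ContinuousOn g (spectrum ℝ B) := hg.mono hspec
  have h := cfc_le_algebraMap (fun x => x - α * g x) _ B
    (fun x hx => le_csSup (hS.bddAbove_image hcont) (Set.mem_image_of_mem _ (hspec hx)))
    (hcont.mono hspec) hB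
  rw [cfc_sub (fun x => x) (fun x => α * g x) B continuousOn_id (continuousOn_const.mul hgB),
    cfc_id' ℝ B, cfc_const_mul α g B hgB, sub_le_iff_le_add',
    Algebra.algebraMap_eq_smul_one] at h
  exact h

/-- The closed convex hull of a finite union of continuous images of compact intervals. -/
theorem isCompact_closure_convexHull_iUnion_image {ι : Type*} [Finite ι] {m M : ι → ℝ}
    {q : ι → ℝ → ℝ} (hq : ∀ j, Continuous (q j)) :
    IsCompact (closure (convexHull ℝ (⋃ j, q j '' Set.Icc (m j) (M j)))) :=
  (isBounded_convexHull.2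
    (isCompact_iUnion fun j => isCompact_Icc.image (hq j)).isBounded).isCompact_closure

theorem sum_mul_pow_le_of_sandwich {s : Finset ℕ} {a κ μ : ℕ → ℝ} (hκ : ∀ i, 1 ≤ κ i)
    (hμ : ∀ i, 1 ≤ μ i) {l y u : ℝ} (hl : 0 ≤ l) (hly : l ≤ y) (hyu : y ≤ u) :
    ∑ i ∈ s, a i * y ^ i ≤
      (∑ i ∈ s.filter (fun i => 0 ≤ a i), a i * κ i * u ^ i) +
        ∑ i ∈ s.filter (fun i => a i < 0), a i * (μ i)⁻¹ * l ^ i := by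
  rw [← Finset.sum_filter_add_sum_filter_not s (fun i => 0 ≤ a i)]
  simp only [not_le]
  have hy : 0 ≤ y := hl.trans hly
  refine add_le_add (Finset.sum_le_sum fun i hi => ?_) (Finset.sum_le_sum fun i hi => ?_)
  · rw [mul_assoc]
    refine mul_le_mul_of_nonneg_left ?_ (Finset.mem_filter.1 hi).2
    exact (pow_le_pow_left₀ hy hyu i).trans
      (le_mul_of_one_le_left (pow_nonneg (hy.trans hyu) i) (hκ i))
  · rw [mul_assoc]
    refine mul_le_mul_of_nonpos_left ?_ (Finset.mem_filter.1 hi).2.le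
    exact (mul_le_of_le_one_left (pow_nonneg hl i) (inv_le_one_of_one_le₀ (hμ i))).trans
      (pow_le_pow_left₀ hl hly i)

theorem cfc_sum_mul_pow {H : Type*} [NormedAddCommGroup H] [InnerProductSpace ℂ H]
    [CompleteSpace H] {A : H →L[ℂ] H} (hA : IsSelfAdjoint A) {f : ℝ → ℝ}
    (hf : ContinuousOn f (spectrum ℝ A)) (a : ℕ → ℝ) (s : Finset ℕ) :
    cfc (fun x => ∑ i ∈ s, a i * f x ^ i) A = ∑ i ∈ s, a i • cfc f A ^ i := by
  have h : (fun x => ∑ i ∈ s, a i * f x ^ i) = ∑ i ∈ s, fun x => a i * f x ^ i := by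
    ext x; simp
  rw [h, cfc_sum (fun i x => a i * f x ^ i) A s fun i _ => continuousOn_const.mul (hf.pow i)]
  refine Finset.sum_congr rfl fun i _ => ?_
  rw [cfc_const_mul (a i) (fun x => f x ^ i) A (hf.pow i), cfc_pow f i A hf hA]

theorem sInf_image_Icc_pos {φ : ℝ → ℝ} {b c : ℝ} (hbc : b ≤ c)
    (hφ : Continuous φ) (hpos : ∀ x ∈ Set.Icc b c, 0 < φ x) :
    0 < sInf (φ '' Set.Icc b c) := by
  obtain ⟨x, hx, hx'⟩ :=
    (isCompact_Icc.image hφ).sInf_mem ((Set.nonempty_Icc.2 hbc).image φ)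
  rw [← hx']
  exact hpos x hx

theorem stmt2
    {H K : Type*} [NormedAddCommGroup H] [InnerProductSpace ℂ H] [CompleteSpace H]
    [NormedAddCommGroup K] [InnerProductSpace ℂ K] [CompleteSpace K]
    (V : K →L[ℂ] H) (hV : (adjoint V) ∘L V = 1)
    (I : ℕ) (a : ℕ → ℝ)
    (k : ℕ) (hk : 1 ≤ k)
    (w : Fin k → ℝ) (hw : ∀ j, 0 ≤ w j) (hw1 : ∑ j, w j = 1)
    (m M : Fin k → ℝ) (hmM : ∀ j, m j < M j)
    (A : Fin k → H →L[ℂ] H) (hA : ∀ j, IsSelfAdjoint (A j))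
    (hspec : ∀ j, spectrum ℝ (A j) ⊆ Set.Icc (m j) (M j))
    (f : ℝ → ℝ) (hf : ContinuousOn f (⋃ j, Set.Icc (m j) (M j)))
    (pL pU : Polynomial ℝ)
    (hp : ∀ x ∈ ⋃ j, Set.Icc (m j) (M j),
      0 < pL.eval x ∧ pL.eval x ≤ f x ∧ f x ≤ pU.eval x)
    (mU MU mL ML : Fin k → ℝ)
    (hmU : ∀ j, mU j = sInf ((fun x => pU.eval x) '' Set.Icc (m j) (M j)))
    (hMU : ∀ j, MU j = sSup ((fun x => pU.eval x) '' Set.Icc (m j) (M j)))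
    (hmL : ∀ j, mL j = sInf ((fun x => pL.eval x) '' Set.Icc (m j) (M j)))
    (hML : ∀ j, ML j = sSup ((fun x => pL.eval x) '' Set.Icc (m j) (M j)))
    (hUlt : ∀ j, mU j < MU j) (hLlt : ∀ j, mL j < ML j)
    (qU qL : Fin k → ℝ → ℝ)
    (hqU : ∀ j x, qU j x =
      (∑ i ∈ (Finset.range (I + 1)).filter (fun i => 0 ≤ a i),
        a i * kantorovich (mU j) (MU j) (i : ℝ) * (pU.eval x) ^ i) +
      ∑ i ∈ (Finset.range (I + 1)).filter (fun i => a i < 0),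
        a i * (kantorovich (mL j) (ML j) (i : ℝ))⁻¹ * (pL.eval x) ^ i)
    (hqL : ∀ j x, qL j x =
      (∑ i ∈ (Finset.range (I + 1)).filter (fun i => 0 ≤ a i),
        a i * (kantorovich (mL j) (ML j) (i : ℝ))⁻¹ * (pL.eval x) ^ i) +
      ∑ i ∈ (Finset.range (I + 1)).filter (fun i => a i < 0),
        a i * kantorovich (mU j) (MU j) (i : ℝ) * (pU.eval x) ^ i)
    (BU BL : K →L[ℂ] K)
    (hBU : BU = ∑ j, w j • ((adjoint V) ∘L (cfc (qU j) (A j)) ∘L V))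
    (hBL : BL = ∑ j, w j • ((adjoint V) ∘L (cfc (qL j) (A j)) ∘L V))
    (SU SL : Set ℝ)
    (hSU : SU = closure (convexHull ℝ (⋃ j, qU j '' Set.Icc (m j) (M j))))
    (hSL : SL = closure (convexHull ℝ (⋃ j, qL j '' Set.Icc (m j) (M j))))
    (g : ℝ → ℝ) (hg : ContinuousOn g SU) (α : ℝ) :
    (∑ j, w j • ((adjoint V) ∘L (∑ i ∈ Finset.range (I + 1), a i • (cfc f (A j)) ^ i) ∘L V)) ≤
      α • cfc g BU + (sSup ((fun x => x - α * g x) '' SU)) • (1 : K →L[ℂ] K) := by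
  have hmem : ∀ j, ∀ x ∈ Set.Icc (m j) (M j), x ∈ ⋃ j, Set.Icc (m j) (M j) :=
    fun j x hx => Set.mem_iUnion.2 ⟨j, hx⟩
  have hκU : ∀ j (i : ℕ), 1 ≤ kantorovich (mU j) (MU j) (i : ℝ) := fun j i =>
    one_le_kantorovich_natCast (hmU j ▸ sInf_image_Icc_pos (hmM j).le pU.continuous fun x hx =>
      have h := hp x (hmem j x hx)
      h.1.trans_le (h.2.1.trans h.2.2)) (hUlt j) i
  have hκL : ∀ j (i : ℕ), 1 ≤ kantorovich (mL j) (ML j) (i : ℝ) := fun j i =>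
    one_le_kantorovich_natCast (hmL j ▸ sInf_image_Icc_pos (hmM j).le pL.continuous fun x hx =>
      (hp x (hmem j x hx)).1) (hLlt j) i
  have hqcont : ∀ j, Continuous (qU j) := fun j => by
    rw [funext (hqU j)]
    fun_prop
  have hfj : ∀ j, ContinuousOn f (spectrum ℝ (A j)) := fun j =>
    hf.mono fun x hx => hmem j x (hspec j hx)
  have hScomp : IsCompact SU := hSU ▸ isCompact_closure_convexHull_iUnion_image hqcont
  have hSconv : Convex ℝ SU := hSU ▸ (convex_convexHull ℝ _).closure
  have hqS : ∀ j, ∀ x ∈ Set.Icc (m j) (M j), qU j x ∈ SU := fun j x hx =>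
    hSU ▸ subset_closure (subset_convexHull ℝ _ (Set.mem_iUnion.2 ⟨j, x, hx, rfl⟩))
  have hSne : SU.Nonempty := ⟨_, hqS ⟨0, hk⟩ _ (Set.left_mem_Icc.2 (hmM _).le)⟩
  have hX : ∀ j, IsSelfAdjoint (cfc (qU j) (A j)) := fun j => cfc_predicate _ _
  have hXS : ∀ j, spectrum ℝ (cfc (qU j) (A j)) ⊆ SU := fun j => by
    rw [cfc_map_spectrum (qU j) (A j) (hA j) (hqcont j).continuousOn]
    rintro _ ⟨x, hx, rfl⟩
    exact hqS j x (hspec j hx)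
  have hBsa : IsSelfAdjoint BU := hBU ▸ isSelfAdjoint_sum_smul_adjoint_conj V w hX
  have hBS : spectrum ℝ BU ⊆ SU :=
    hBU ▸ spectrum_sum_smul_adjoint_conj_subset hV hw hw1 hX hScomp hSne hSconv hXS
  refine le_trans ?_ (le_smul_cfc_add_sSup_smul_one hBsa hScomp hBS hg α)
  rw [hBU]
  refine sum_smul_adjoint_conj_mono V hw fun j => ?_
  rw [← cfc_sum_mul_pow (hA j) (hfj j)]
  refine cfc_mono (fun x hx => ?_)
    (continuousOn_finsetSum _ fun i _ => continuousOn_const.mul ((hfj j).pow i))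
    (hqcont j).continuousOn
  obtain ⟨h0, h1, h2⟩ := hp x (hmem j x (hspec j hx))
  rw [hqU]
  exact sum_mul_pow_le_of_sandwich (hκU j) (hκL j) h0.le h1 h2
end

section
/- Let g be a continuous real function on S_L with g(x) > 0 for all x ∈ S_L. Then Σ_{j=1}^k w_j Φ(f(A_j)) ≥ ( min_{x ∈ S_L} x/g(x) )·g(B_L) in the Loewner order, where g(B_L) is defined by continuous functional calculus. -/
open ContinuousLinearMap Polynomial

/-- The chord of `t ↦ t ^ n` over `[m, M]` lies below `K(m, M, n) t ^ n`, so `K(m, M, n) ≥ 1`. -/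
theorem one_le_kantorovich {m M : ℝ} (hm : 0 < m) (hmM : m < M) (n : ℕ) :
    1 ≤ kantorovich m M n := by
  unfold kantorovich
  split_ifs with h
  · exact le_rfl
  push Not at h
  have hn : 2 ≤ n := by
    have h0 : n ≠ 0 := by exact_mod_cast h.1
    have h1 : n ≠ 1 := by exact_mod_cast h.2
    omega
  have hn' : (2 : ℝ) ≤ n := by exact_mod_cast hn
  simp only [Real.rpow_natCast]
  have hM : 0 < M := hm.trans hmM
  have hD : 0 < M - m := sub_pos.2 hmM
  have hF : 0 < M ^ n - m ^ n := sub_pos.2 (pow_lt_pow_left₀ hmM hm.le (by omega))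
  have hE : 0 < m * M ^ n - M * m ^ n := by
    obtain ⟨l, rfl⟩ : ∃ l, n = l + 1 := ⟨n - 1, by omega⟩
    have hl : m ^ l < M ^ l := pow_lt_pow_left₀ hmM hm.le (by omega)
    have : m * M ^ (l + 1) - M * m ^ (l + 1) = m * M * (M ^ l - m ^ l) := by ring
    rw [this]
    exact mul_pos (mul_pos hm hM) (sub_pos.2 hl)
  have hn1 : (0 : ℝ) < n - 1 := by linarith
  have hn0 : (0 : ℝ) < n := by linarith
  set P := (m * M ^ n - M * m ^ n) / ((n - 1) * (M - m)) with hP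
  set Q := ((n - 1) * (M ^ n - m ^ n)) / (n * (m * M ^ n - M * m ^ n)) with hQ
  have hPpos : 0 < P := by positivity
  have hQpos : 0 < Q := by positivity
  have bernoulli : 1 + (n : ℝ) * (Q * m - 1) ≤ (1 + (Q * m - 1)) ^ n :=
    one_add_mul_le_pow (by nlinarith [mul_pos hQpos hm]) n
  have chord : P * (1 + (n : ℝ) * (Q * m - 1)) = m ^ n := by
    rw [hP, hQ]
    field_simp
    ring
  have key : m ^ n ≤ P * Q ^ n * m ^ n := by
    calc m ^ n = P * (1 + (n : ℝ) * (Q * m - 1)) := chord.symm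
      _ ≤ P * (1 + (Q * m - 1)) ^ n := mul_le_mul_of_nonneg_left bernoulli hPpos.le
      _ = P * Q ^ n * m ^ n := by rw [add_sub_cancel, mul_pow, mul_assoc]
  exact le_of_mul_le_mul_right (by simpa using key) (pow_pos hm n)

theorem ContinuousOn.sInf_image_Icc_pos {p : ℝ → ℝ} {a b : ℝ} (hab : a ≤ b)
    (hp : ContinuousOn p (Set.Icc a b)) (hpos : ∀ x ∈ Set.Icc a b, 0 < p x) :
    0 < sInf (p '' Set.Icc a b) := by
  obtain ⟨x, hx, hx'⟩ := (isCompact_Icc.image_of_continuousOn hp).sInf_mem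
    ((Set.nonempty_Icc.2 hab).image p)
  exact hx' ▸ hpos x hx

theorem ContinuousLinearMap.adjoint_conj_mono {H K : Type*}
    [NormedAddCommGroup H] [InnerProductSpace ℂ H] [CompleteSpace H]
    [NormedAddCommGroup K] [InnerProductSpace ℂ K] [CompleteSpace K]
    (V : K →L[ℂ] H) {X Y : H →L[ℂ] H} (h : X ≤ Y) :
    (adjoint V) ∘L X ∘L V ≤ (adjoint V) ∘L Y ∘L V := by
  rw [ContinuousLinearMap.le_def] at h ⊢
  have := h.adjoint_conj V
  simpa only [ContinuousLinearMap.sub_comp, ContinuousLinearMap.comp_sub] using this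

theorem sum_weights_smul_le {κ E : Type*} [Fintype κ] [NormedAddCommGroup E]
    [InnerProductSpace ℂ E] [CompleteSpace E] {w : κ → ℝ} (hw : ∀ j, 0 ≤ w j)
    {X Y : κ → E →L[ℂ] E} (h : ∀ j, X j ≤ Y j) :
    ∑ j, w j • X j ≤ ∑ j, w j • Y j :=
  Finset.sum_le_sum fun j _ => smul_le_smul_of_nonneg_left (h j) (hw j)

/-- If `g > 0` on a compact set containing the spectrum of `B` and
`c` is the minimum of `x / g x` on that set, then `c g(B) ≤ B`. -/
theorem sInf_div_smul_cfc_le {K : Type*} [NormedAddCommGroup K] [InnerProductSpace ℂ K]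
    [CompleteSpace K] {B : K →L[ℂ] K} (hB : IsSelfAdjoint B) {S : Set ℝ} (hS : IsCompact S)
    (hBS : spectrum ℝ B ⊆ S) {g : ℝ → ℝ} (hg : ContinuousOn g S) (hgpos : ∀ x ∈ S, 0 < g x) :
    sInf ((fun x => x / g x) '' S) • cfc g B ≤ B := by
  have hgB := hg.mono hBS
  have hbdd : BddBelow ((fun x => x / g x) '' S) :=
    (hS.image_of_continuousOn
      (continuousOn_id.div hg fun x hx => (hgpos x hx).ne')).bddBelow
  calc sInf ((fun x => x / g x) '' S) • cfc g B
      = cfc (fun x => sInf ((fun x => x / g x) '' S) • g x) B := (cfc_smul _ g B hgB).symm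
    _ ≤ cfc (fun x => x) B := by
        refine cfc_mono (fun x hx => ?_) (continuousOn_const.mul hgB) continuousOn_id
        have := csInf_le hbdd (Set.mem_image_of_mem (fun x => x / g x) (hBS hx))
        exact (le_div_iff₀ (hgpos x (hBS hx))).1 this
    _ = B := cfc_id' ℝ B

theorem sum_smul_cfc_pow {H : Type*} [NormedAddCommGroup H] [InnerProductSpace ℂ H]
    [CompleteSpace H] {A : H →L[ℂ] H} (hA : IsSelfAdjoint A) {f : ℝ → ℝ}
    (hf : ContinuousOn f (spectrum ℝ A)) (a : ℕ → ℝ) (s : Finset ℕ) :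
    ∑ i ∈ s, a i • (cfc f A) ^ i = cfc (fun x => ∑ i ∈ s, a i * f x ^ i) A := by
  have := cfc_sum (R := ℝ) (fun i x => a i * f x ^ i) A s
    (fun i _ => continuousOn_const.mul (hf.pow i))
  rw [show (fun x => ∑ i ∈ s, a i * f x ^ i) = ∑ i ∈ s, fun x => a i * f x ^ i by
    ext x; simp, this]
  refine Finset.sum_congr rfl fun i _ => ?_
  rw [cfc_const_mul (a i) (fun x => f x ^ i) A (hf.pow i), cfc_pow f i A hf]

/-- Scalar form of the lower bound. -/
theorem kantorovich_lower_bound_le_sum {mL ML mU MU l u y : ℝ} (hmL : 0 < mL) (hL : mL < ML)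
    (hmU : 0 < mU) (hU : mU < MU) (hl : 0 < l) (hly : l ≤ y) (hyu : y ≤ u) (a : ℕ → ℝ)
    (s : Finset ℕ) :
    (∑ i ∈ s.filter (fun i => 0 ≤ a i), a i * (kantorovich mL ML (i : ℝ))⁻¹ * l ^ i) +
      ∑ i ∈ s.filter (fun i => a i < 0), a i * kantorovich mU MU (i : ℝ) * u ^ i ≤
    ∑ i ∈ s, a i * y ^ i := by
  rw [← Finset.sum_filter_add_sum_filter_not s (fun i => 0 ≤ a i) (fun i => a i * y ^ i)]
  simp only [not_le]
  refine add_le_add (Finset.sum_le_sum fun i hi => ?_) (Finset.sum_le_sum fun i hi => ?_)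
  · have hai := (Finset.mem_filter.1 hi).2
    have hK := inv_le_one_of_one_le₀ (one_le_kantorovich hmL hL i)
    rw [mul_assoc]
    refine mul_le_mul_of_nonneg_left ?_ hai
    calc (kantorovich mL ML (i : ℝ))⁻¹ * l ^ i ≤ 1 * l ^ i :=
          mul_le_mul_of_nonneg_right hK (by positivity)
      _ ≤ y ^ i := by rw [one_mul]; gcongr
  · have hai := (Finset.mem_filter.1 hi).2
    have hK := one_le_kantorovich hmU hU i
    have hy : 0 < y := hl.trans_le hly
    have hu : 0 < u := hy.trans_le hyu
    rw [mul_assoc]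
    refine mul_le_mul_of_nonpos_left ?_ hai.le
    calc y ^ i ≤ 1 * u ^ i := by rw [one_mul]; gcongr
      _ ≤ kantorovich mU MU (i : ℝ) * u ^ i :=
          mul_le_mul_of_nonneg_right hK (by positivity)

/-- The spectrum of a weighted compression lies in any compact convex set containing the
values of the functions. -/
theorem spectrum_sum_compression_subset {κ H K : Type*} [Fintype κ]
    [NormedAddCommGroup H] [InnerProductSpace ℂ H] [CompleteSpace H]
    [NormedAddCommGroup K] [InnerProductSpace ℂ K] [CompleteSpace K]
    (V : K →L[ℂ] H) (hV : (adjoint V) ∘L V = 1)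
    {w : κ → ℝ} (hw : ∀ j, 0 ≤ w j) (hw1 : ∑ j, w j = 1)
    {A : κ → H →L[ℂ] H} (hA : ∀ j, IsSelfAdjoint (A j)) {q : κ → ℝ → ℝ}
    (hq : ∀ j, ContinuousOn (q j) (spectrum ℝ (A j)))
    {S : Set ℝ} (hS : IsCompact S) (hconv : Convex ℝ S) (hne : S.Nonempty)
    (hqS : ∀ j, ∀ x ∈ spectrum ℝ (A j), q j x ∈ S)
    (hB : IsSelfAdjoint (∑ j, w j • ((adjoint V) ∘L (cfc (q j) (A j)) ∘L V))) :
    spectrum ℝ (∑ j, w j • ((adjoint V) ∘L (cfc (q j) (A j)) ∘L V)) ⊆ S := by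
  have hconst : ∀ r : ℝ, ∑ j, w j • ((adjoint V) ∘L (algebraMap ℝ (H →L[ℂ] H) r) ∘L V) =
      algebraMap ℝ (K →L[ℂ] K) r := by
    intro r
    have : (adjoint V) ∘L (algebraMap ℝ (H →L[ℂ] H) r) ∘L V = algebraMap ℝ (K →L[ℂ] K) r := by
      have h1 : (adjoint V) ∘L (r • (1 : H →L[ℂ] H)) ∘L V = r • ((adjoint V) ∘L V) := by
        ext x
        simp
      rw [Algebra.algebraMap_eq_smul_one, Algebra.algebraMap_eq_smul_one, h1, hV]
    simp only [this]
    rw [← Finset.sum_smul, hw1, one_smul]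
  have lower : algebraMap ℝ (K →L[ℂ] K) (sInf S) ≤
      ∑ j, w j • ((adjoint V) ∘L (cfc (q j) (A j)) ∘L V) := by
    rw [← hconst]
    exact sum_weights_smul_le hw fun j => adjoint_conj_mono V <|
      algebraMap_le_cfc (q j) _ (A j) (fun x hx => csInf_le hS.bddBelow (hqS j x hx)) (hq j) (hA j)
  have upper : ∑ j, w j • ((adjoint V) ∘L (cfc (q j) (A j)) ∘L V) ≤
      algebraMap ℝ (K →L[ℂ] K) (sSup S) := by
    rw [← hconst]
    exact sum_weights_smul_le hw fun j => adjoint_conj_mono V <|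
      cfc_le_algebraMap (q j) _ (A j) (fun x hx => le_csSup hS.bddAbove (hqS j x hx)) (hq j) (hA j)
  intro x hx
  exact hconv.ordConnected.out (hS.sInf_mem hne) (hS.sSup_mem hne)
    ⟨(algebraMap_le_iff_le_spectrum hB).1 lower x hx,
      (le_algebraMap_iff_spectrum_le hB).1 upper x hx⟩

theorem stmt8
    {H K : Type*} [NormedAddCommGroup H] [InnerProductSpace ℂ H] [CompleteSpace H]
    [NormedAddCommGroup K] [InnerProductSpace ℂ K] [CompleteSpace K]
    (V : K →L[ℂ] H) (hV : (adjoint V) ∘L V = 1)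
    (I : ℕ) (a : ℕ → ℝ)
    (k : ℕ) (hk : 1 ≤ k)
    (w : Fin k → ℝ) (hw : ∀ j, 0 ≤ w j) (hw1 : ∑ j, w j = 1)
    (m M : Fin k → ℝ) (hmM : ∀ j, m j < M j)
    (A : Fin k → H →L[ℂ] H) (hA : ∀ j, IsSelfAdjoint (A j))
    (hspec : ∀ j, spectrum ℝ (A j) ⊆ Set.Icc (m j) (M j))
    (f : ℝ → ℝ) (hf : ContinuousOn f (⋃ j, Set.Icc (m j) (M j)))
    (pL pU : Polynomial ℝ)
    (hp : ∀ x ∈ ⋃ j, Set.Icc (m j) (M j),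
      0 < pL.eval x ∧ pL.eval x ≤ f x ∧ f x ≤ pU.eval x)
    (mU MU mL ML : Fin k → ℝ)
    (hmU : ∀ j, mU j = sInf ((fun x => pU.eval x) '' Set.Icc (m j) (M j)))
    (hMU : ∀ j, MU j = sSup ((fun x => pU.eval x) '' Set.Icc (m j) (M j)))
    (hmL : ∀ j, mL j = sInf ((fun x => pL.eval x) '' Set.Icc (m j) (M j)))
    (hML : ∀ j, ML j = sSup ((fun x => pL.eval x) '' Set.Icc (m j) (M j)))
    (hUlt : ∀ j, mU j < MU j) (hLlt : ∀ j, mL j < ML j)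
    (qU qL : Fin k → ℝ → ℝ)
    (hqU : ∀ j x, qU j x =
      (∑ i ∈ (Finset.range (I + 1)).filter (fun i => 0 ≤ a i),
        a i * kantorovich (mU j) (MU j) (i : ℝ) * (pU.eval x) ^ i) +
      ∑ i ∈ (Finset.range (I + 1)).filter (fun i => a i < 0),
        a i * (kantorovich (mL j) (ML j) (i : ℝ))⁻¹ * (pL.eval x) ^ i)
    (hqL : ∀ j x, qL j x =
      (∑ i ∈ (Finset.range (I + 1)).filter (fun i => 0 ≤ a i),
        a i * (kantorovich (mL j) (ML j) (i : ℝ))⁻¹ * (pL.eval x) ^ i) +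
      ∑ i ∈ (Finset.range (I + 1)).filter (fun i => a i < 0),
        a i * kantorovich (mU j) (MU j) (i : ℝ) * (pU.eval x) ^ i)
    (BU BL : K →L[ℂ] K)
    (hBU : BU = ∑ j, w j • ((adjoint V) ∘L (cfc (qU j) (A j)) ∘L V))
    (hBL : BL = ∑ j, w j • ((adjoint V) ∘L (cfc (qL j) (A j)) ∘L V))
    (SU SL : Set ℝ)
    (hSU : SU = closure (convexHull ℝ (⋃ j, qU j '' Set.Icc (m j) (M j))))
    (hSL : SL = closure (convexHull ℝ (⋃ j, qL j '' Set.Icc (m j) (M j))))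
    (g : ℝ → ℝ) (hg : ContinuousOn g SL) (hgpos : ∀ x ∈ SL, 0 < g x) :
    (sInf ((fun x => x / g x) '' SL)) • cfc g BL ≤
      (∑ j, w j • ((adjoint V) ∘L (∑ i ∈ Finset.range (I + 1), a i • (cfc f (A j)) ^ i) ∘L V)) := by
  have hsub : ∀ j, Set.Icc (m j) (M j) ⊆ ⋃ j, Set.Icc (m j) (M j) :=
    fun j => Set.subset_iUnion (fun j => Set.Icc (m j) (M j)) j
  have hpL : ∀ j, 0 < mL j := fun j => hmL j ▸
    ContinuousOn.sInf_image_Icc_pos (hmM j).le pL.continuous.continuousOn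
      fun x hx => (hp x (hsub j hx)).1
  have hpU : ∀ j, 0 < mU j := fun j => hmU j ▸
    ContinuousOn.sInf_image_Icc_pos (hmM j).le pU.continuous.continuousOn fun x hx => by
      obtain ⟨h1, h2, h3⟩ := hp x (hsub j hx)
      linarith
  have hqc : ∀ j, Continuous (qL j) := fun j => by
    rw [funext (hqL j)]
    have := pL.continuous
    have := pU.continuous
    fun_prop
  have hScpt : IsCompact SL := by
    have hU : IsCompact (⋃ j, qL j '' Set.Icc (m j) (M j)) :=
      isCompact_iUnion fun j => isCompact_Icc.image (hqc j)
    rw [hSL]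
    exact (isBounded_convexHull.2 hU.isBounded).isCompact_closure
  have hSconv : Convex ℝ SL := hSL ▸ (convex_convexHull ℝ _).closure
  have hqS : ∀ j, ∀ x ∈ Set.Icc (m j) (M j), qL j x ∈ SL := fun j x hx => by
    rw [hSL]
    exact subset_closure <| subset_convexHull ℝ _ <|
      Set.mem_iUnion.2 ⟨j, Set.mem_image_of_mem _ hx⟩
  have hSne : SL.Nonempty := ⟨_, hqS ⟨0, hk⟩ _ (Set.left_mem_Icc.2 (hmM _).le)⟩
  have hBsa : IsSelfAdjoint BL := by
    rw [hBL]
    refine isSelfAdjoint_sum _ fun j _ => ?_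
    exact (IsSelfAdjoint.all (w j)).smul ((cfc_predicate (qL j) (A j)).adjoint_conj V)
  have hBspec : spectrum ℝ BL ⊆ SL := by
    subst hBL
    exact spectrum_sum_compression_subset V hV hw hw1 hA (fun j => (hqc j).continuousOn) hScpt
      hSconv hSne (fun j x hx => hqS j x (hspec j hx)) hBsa
  refine (sInf_div_smul_cfc_le hBsa hScpt hBspec hg hgpos).trans ?_
  rw [hBL]
  refine sum_weights_smul_le hw fun j => adjoint_conj_mono V ?_
  have hfj : ContinuousOn f (spectrum ℝ (A j)) := hf.mono ((hspec j).trans (hsub j))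
  rw [sum_smul_cfc_pow (hA j) hfj]
  refine cfc_mono (fun x hx => ?_) (hqc j).continuousOn
    (continuousOn_finsetSum _ fun i _ => continuousOn_const.mul (hfj.pow i))
  obtain ⟨h1, h2, h3⟩ := hp x (hsub j (hspec j hx))
  rw [hqL]
  exact kantorovich_lower_bound_le_sum (hpL j) (hLlt j) (hpU j) (hUlt j) h1 h2 h3 a _
end
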